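/- arXiv:1401.0472 — 2 statements merged into one kernel-verified Lean document; each statement's English description precedes it below -/
import Mathlib

section
/- Let φ, ψ : [0,1] → ℝ be positive functions, infinitely differentiable on the closed interval [0,1], with φ(s) = ψ(√(1−s²)) for all s ∈ [0,1], and suppose that φ(s) − sφ'(s) + (1−s²)φ''(s) > 0 for all s ∈ [0,1]. Then φ(s) − sφ'(s) > 0 for all s ∈ [0,1]; consequently φ(s) − sφ'(s) + (b² − s²)φ''(s) > 0 for all 0 ≤ s ≤ b ≤ 1, and the same two conclusions hold with ψ in place of φ. -/
/-- The (one-sided) derivative of a function on the closed interval `[0, 1]`. -/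
noncomputable def dIcc (f : ℝ → ℝ) : ℝ → ℝ := derivWithin f (Set.Icc 0 1)

open Set

lemma contDiffOn_dIcc {f : ℝ → ℝ} (hf : ContDiffOn ℝ (⊤ : ℕ∞) f (Icc 0 1)) :
    ContDiffOn ℝ (⊤ : ℕ∞) (dIcc f) (Icc 0 1) :=
  hf.derivWithin (uniqueDiffOn_Icc zero_lt_one) (by simp)

lemma hasDerivAt_dIcc {f : ℝ → ℝ} (hf : ContDiffOn ℝ (⊤ : ℕ∞) f (Icc 0 1)) {t : ℝ}
    (ht : t ∈ Ioo (0 : ℝ) 1) : HasDerivAt f (dIcc f t) t :=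
  ((hf.differentiableOn (by simp)) t (Ioo_subset_Icc_self ht)).hasDerivWithinAt.hasDerivAt
    (Icc_mem_nhds ht.1 ht.2)

/-- The expression `f(s) - s f'(s) + (1 - s²) f''(s)`. -/
noncomputable def convexityExpr (f : ℝ → ℝ) (s : ℝ) : ℝ :=
  f s - s * dIcc f s + (1 - s ^ 2) * dIcc (dIcc f) s

lemma continuousOn_convexityExpr {f : ℝ → ℝ} (hf : ContDiffOn ℝ (⊤ : ℕ∞) f (Icc 0 1)) :
    ContinuousOn (convexityExpr f) (Icc 0 1) := by
  have h0 := hf.continuousOn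
  have h1 := (contDiffOn_dIcc hf).continuousOn
  have h2 := (contDiffOn_dIcc (contDiffOn_dIcc hf)).continuousOn
  unfold convexityExpr
  fun_prop

lemma sqrt_one_sub_sq_mem_Icc (t : ℝ) : √(1 - t ^ 2) ∈ Icc (0 : ℝ) 1 :=
  ⟨Real.sqrt_nonneg _, Real.sqrt_le_one.mpr (by nlinarith [sq_nonneg t])⟩

lemma sqrt_one_sub_sq_mem_Ioo {t : ℝ} (ht : t ∈ Ioo (0 : ℝ) 1) :
    √(1 - t ^ 2) ∈ Ioo (0 : ℝ) 1 :=
  ⟨Real.sqrt_pos.mpr (by nlinarith [ht.1, ht.2]),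
    (Real.sqrt_lt' one_pos).mpr (by nlinarith [ht.1, ht.2])⟩

lemma sqrt_one_sub_sqrt_one_sub_sq {t : ℝ} (ht : t ∈ Icc (0 : ℝ) 1) :
    √(1 - √(1 - t ^ 2) ^ 2) = t := by
  rw [Real.sq_sqrt (by nlinarith [ht.1, ht.2]), sub_sub_cancel, Real.sqrt_sq ht.1]

lemma hasDerivAt_sqrt_one_sub_sq {t : ℝ} (ht : t ∈ Ioo (0 : ℝ) 1) :
    HasDerivAt (fun x : ℝ => √(1 - x ^ 2)) (-t / √(1 - t ^ 2)) t := by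
  have hpos : 0 < 1 - t ^ 2 := by nlinarith [ht.1, ht.2]
  have hs := (((hasDerivAt_id t).pow 2).const_sub 1).sqrt hpos.ne'
  refine hs.congr_deriv ?_
  have := (Real.sqrt_pos.mpr hpos).ne'
  simp only [id, Pi.pow_apply]
  field_simp
  norm_num

lemma sub_mul_dIcc_pos {f : ℝ → ℝ} (hf : ContDiffOn ℝ (⊤ : ℕ∞) f (Icc 0 1))
    (hconv : ∀ s ∈ Icc (0 : ℝ) 1, 0 < convexityExpr f s) {s : ℝ} (hs : s ∈ Icc (0 : ℝ) 1) :
    0 < f s - s * dIcc f s := by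
  rcases hs.2.eq_or_lt with rfl | hs1
  · simpa [convexityExpr] using hconv 1 hs
  have hanti : StrictAntiOn (fun x => √(1 - x ^ 2) * (f x - x * dIcc f x)) (Icc 0 1) := by
    have h0 := hf.continuousOn
    have h1 := (contDiffOn_dIcc hf).continuousOn
    refine strictAntiOn_of_deriv_neg (convex_Icc 0 1) (by fun_prop) fun x hx => ?_
    rw [interior_Icc] at hx
    have hd := (hasDerivAt_sqrt_one_sub_sq hx).mul ((hasDerivAt_dIcc hf hx).sub
      ((hasDerivAt_id x).mul (hasDerivAt_dIcc (contDiffOn_dIcc hf) hx)))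
    have hr := (sqrt_one_sub_sq_mem_Ioo hx).1
    have hr2 : √(1 - x ^ 2) ^ 2 = 1 - x ^ 2 := Real.sq_sqrt (by nlinarith [hx.1, hx.2])
    have hE := mul_pos hx.1 (hconv x (Ioo_subset_Icc_self hx))
    refine (hd.congr_deriv (g' := -(x * convexityExpr f x) / √(1 - x ^ 2)) ?_).deriv.trans_lt
      (div_neg_of_neg_of_pos (by linarith) hr)
    simp only [convexityExpr, id, Pi.sub_apply, Pi.mul_apply]
    generalize √(1 - x ^ 2) = r at hr hr2
    rw [← hr2]
    field_simp
    ring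
  have h := hanti hs (right_mem_Icc.mpr zero_le_one) hs1
  simp only [one_pow, sub_self, Real.sqrt_zero, zero_mul] at h
  exact pos_of_mul_pos_right h (Real.sqrt_nonneg _)

lemma sub_mul_dIcc_add_pos {f : ℝ → ℝ} (hf : ContDiffOn ℝ (⊤ : ℕ∞) f (Icc 0 1))
    (hconv : ∀ s ∈ Icc (0 : ℝ) 1, 0 < convexityExpr f s) {s b : ℝ} (hs : 0 ≤ s) (hsb : s ≤ b)
    (hb : b ≤ 1) : 0 < f s - s * dIcc f s + (b ^ 2 - s ^ 2) * dIcc (dIcc f) s := by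
  have hsI : s ∈ Icc (0 : ℝ) 1 := ⟨hs, hsb.trans hb⟩
  have hQ := sub_mul_dIcc_pos hf hconv hsI
  have hE := hconv s hsI
  unfold convexityExpr at hE
  rcases le_total 0 (dIcc (dIcc f) s) with h | h
  · have : 0 ≤ b ^ 2 - s ^ 2 := by nlinarith
    positivity
  · have : (1 - b ^ 2) * dIcc (dIcc f) s ≤ 0 :=
      mul_nonpos_of_nonneg_of_nonpos (by nlinarith) h
    linarith

lemma convexityExpr_eq_comp_sqrt {f g : ℝ → ℝ} (hf : ContDiffOn ℝ (⊤ : ℕ∞) f (Icc 0 1))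
    (hg : ContDiffOn ℝ (⊤ : ℕ∞) g (Icc 0 1))
    (hrel : ∀ t ∈ Icc (0 : ℝ) 1, g t = f (√(1 - t ^ 2))) :
    EqOn (convexityExpr g) (fun t => convexityExpr f (√(1 - t ^ 2))) (Icc 0 1) := by
  have hfirst : EqOn (fun t => √(1 - t ^ 2) * dIcc g t)
      (fun t => -t * dIcc f (√(1 - t ^ 2))) (Ioo 0 1) := fun t ht => by
    have hs := sqrt_one_sub_sq_mem_Ioo ht
    have hd := (hasDerivAt_dIcc hf hs).comp t (hasDerivAt_sqrt_one_sub_sq ht)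
    have heq : g =ᶠ[nhds t] f ∘ fun x => √(1 - x ^ 2) := by
      filter_upwards [Icc_mem_nhds ht.1 ht.2] with x hx using hrel x hx
    have := (hasDerivAt_dIcc hg ht).unique (hd.congr_of_eventuallyEq heq)
    have := hs.1.ne'
    simp only [*]
    field_simp
  have hIoo : EqOn (convexityExpr g) (fun t => convexityExpr f (√(1 - t ^ 2))) (Ioo 0 1) :=
    fun t ht => by
    have hs := sqrt_one_sub_sq_mem_Ioo ht
    have hsd := hasDerivAt_sqrt_one_sub_sq ht
    have hl := hsd.mul (hasDerivAt_dIcc (contDiffOn_dIcc hg) ht)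
    have hr := (hasDerivAt_id t).neg.mul
      ((hasDerivAt_dIcc (contDiffOn_dIcc hf) hs).comp t hsd)
    have h := hl.unique (hr.congr_of_eventuallyEq
      (hfirst.eventuallyEq_of_mem (Ioo_mem_nhds ht.1 ht.2)))
    have hs2 : √(1 - t ^ 2) ^ 2 = 1 - t ^ 2 := Real.sq_sqrt (by nlinarith [ht.1, ht.2])
    have hs0 := hs.1.ne'
    simp only [convexityExpr, hrel t (Ioo_subset_Icc_self ht)]
    simp only [Pi.neg_apply, id, Function.comp_apply] at h
    generalize √(1 - t ^ 2) = r at h hs2 hs0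
    rw [← hs2, show 1 - r ^ 2 = t ^ 2 by rw [hs2]; ring]
    field_simp at h
    linarith
  have hcl : Icc (0 : ℝ) 1 ⊆ closure (Ioo 0 1) := (closure_Ioo zero_ne_one).ge
  refine hIoo.of_subset_closure (continuousOn_convexityExpr hg) ?_ Ioo_subset_Icc_self hcl
  exact (continuousOn_convexityExpr hf).comp (by fun_prop) fun t _ => sqrt_one_sub_sq_mem_Icc t

/-- Let `φ, ψ : [0,1] → ℝ` be positive, smooth on the closed interval
`[0,1]`, with `φ(s) = ψ(√(1 - s²))`, and suppose `φ(s) - s φ'(s) + (1 - s²) φ''(s) > 0`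
on `[0,1]`. Then `φ(s) - s φ'(s) > 0` on `[0,1]`; consequently
`φ(s) - s φ'(s) + (b² - s²) φ''(s) > 0` whenever `0 ≤ s ≤ b ≤ 1`, and the same two
conclusions hold for `ψ`. -/
theorem statement17 (φ ψ : ℝ → ℝ)
    (hφpos : ∀ s ∈ Set.Icc (0 : ℝ) 1, 0 < φ s)
    (hψpos : ∀ s ∈ Set.Icc (0 : ℝ) 1, 0 < ψ s)
    (hφsmooth : ContDiffOn ℝ (⊤ : ℕ∞) φ (Set.Icc 0 1))
    (hψsmooth : ContDiffOn ℝ (⊤ : ℕ∞) ψ (Set.Icc 0 1))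
    (hrel : ∀ s ∈ Set.Icc (0 : ℝ) 1, φ s = ψ (Real.sqrt (1 - s ^ 2)))
    (hconv : ∀ s ∈ Set.Icc (0 : ℝ) 1,
      0 < φ s - s * dIcc φ s + (1 - s ^ 2) * dIcc (dIcc φ) s) :
    (∀ s ∈ Set.Icc (0 : ℝ) 1, 0 < φ s - s * dIcc φ s) ∧
    (∀ s b : ℝ, 0 ≤ s → s ≤ b → b ≤ 1 →
      0 < φ s - s * dIcc φ s + (b ^ 2 - s ^ 2) * dIcc (dIcc φ) s) ∧
    (∀ s ∈ Set.Icc (0 : ℝ) 1, 0 < ψ s - s * dIcc ψ s) ∧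
    (∀ s b : ℝ, 0 ≤ s → s ≤ b → b ≤ 1 →
      0 < ψ s - s * dIcc ψ s + (b ^ 2 - s ^ 2) * dIcc (dIcc ψ) s) := by
  have hrel' : ∀ t ∈ Icc (0 : ℝ) 1, ψ t = φ (√(1 - t ^ 2)) := fun t ht => by
    rw [hrel _ (sqrt_one_sub_sq_mem_Icc t), sqrt_one_sub_sqrt_one_sub_sq ht]
  have hconv' : ∀ t ∈ Icc (0 : ℝ) 1, 0 < convexityExpr ψ t := fun t ht => by
    rw [convexityExpr_eq_comp_sqrt hφsmooth hψsmooth hrel' ht]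
    exact hconv _ (sqrt_one_sub_sq_mem_Icc t)
  exact ⟨fun s hs => sub_mul_dIcc_pos hφsmooth hconv hs,
    fun s b => sub_mul_dIcc_add_pos hφsmooth hconv,
    fun s hs => sub_mul_dIcc_pos hψsmooth hconv' hs,
    fun s b => sub_mul_dIcc_add_pos hψsmooth hconv'⟩
end

section
/- Fix integers n₁ ≥ n₂ ≥ 2 and set n = n₁ + n₂; write y = (y₁, y₂) ∈ ℝⁿ = ℝ^{n₁} × ℝ^{n₂}, α₁(y) = ‖y₁‖, α₂(y) = ‖y₂‖. Let Q = {(u, v) ∈ ℝ² : u ≥ 0, v ≥ 0} ∖ {(0,0)} and let L : Q → ℝ be a function such that F : ℝⁿ → ℝ, defined by F(0) = 0 and F(y) = √(L(α₁(y)², α₂(y)²)) for y ≠ 0, is a Minkowski norm on ℝⁿ. Then L is smooth on Q, i.e., L is infinitely differentiable in the sense that it locally extends to a C^∞ function on an open neighborhood in ℝ² of every point of Q. -/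
/-- A Minkowski norm on a real normed vector space `E`: a continuous nonnegative function,
smooth away from the origin, positively homogeneous of degree one, and strongly convex in
the sense that for every `y ≠ 0` the Hessian `g_y(v, v) = (1/2) D²(F²)(y)[v, v]` is
positive definite. -/
def IsMinkowskiNorm {E : Type*} [NormedAddCommGroup E] [NormedSpace ℝ E] (F : E → ℝ) : Prop :=
  Continuous F ∧ (∀ y, 0 ≤ F y) ∧
    ContDiffOn ℝ (⊤ : ℕ∞) F {(0 : E)}ᶜ ∧
    (∀ (c : ℝ) (y : E), 0 < c → F (c • y) = c * F y) ∧
    ∀ y : E, y ≠ 0 → ∀ v : E, v ≠ 0 →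
      0 < (1 / 2 : ℝ) * fderiv ℝ (fun z : E => fderiv ℝ (fun w : E => F w ^ 2) z v) y v

/-- The closed first quadrant of `ℝ²` with the origin removed. -/
def quadrantQ : Set (ℝ × ℝ) := {p | (0 ≤ p.1 ∧ 0 ≤ p.2) ∧ p ≠ 0}

open Set Filter Topology Asymptotics
open scoped Nat

/-- A smooth function on the line all of whose derivatives vanish at the origin. -/
def IsFlatAtZero (f : ℝ → ℝ) : Prop :=
  ContDiff ℝ (⊤ : ℕ∞) f ∧ ∀ n, iteratedDeriv n f 0 = 0

theorem isFlatAtZero_deriv {f : ℝ → ℝ} (hf : IsFlatAtZero f) : IsFlatAtZero (deriv f) := by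
  refine ⟨(contDiff_infty_iff_deriv.1 hf.1).2, fun n => ?_⟩
  rw [← iteratedDeriv_succ']
  exact hf.2 _

theorem IsFlatAtZero.isLittleO_pow {f : ℝ → ℝ} (hf : IsFlatAtZero f) (m : ℕ) :
    f =o[𝓝 0] fun x => x ^ m := by
  have h := taylor_isLittleO_univ (x₀ := 0) (n := m) (f := f) (hf.1.of_le (mod_cast le_top))
  simpa [taylor_within_apply, iteratedDerivWithin_univ, hf.2] using h

/-- The function `u ↦ f (√u) / (√u) ^ m` on the positive half-line, extended by zero. -/
noncomputable def sqrtQuotient (f : ℝ → ℝ) (m : ℕ) (u : ℝ) : ℝ :=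
  if 0 < u then f √u / √u ^ m else 0

theorem hasDerivAt_sqrtQuotient {f : ℝ → ℝ} (hf : IsFlatAtZero f) (m : ℕ) (u : ℝ) :
    HasDerivAt (sqrtQuotient f m)
      (1 / 2 * sqrtQuotient (deriv f) (m + 1) u - m / 2 * sqrtQuotient f (m + 2) u) u := by
  rcases lt_trichotomy u 0 with hu | rfl | hu
  · have h : sqrtQuotient f m =ᶠ[𝓝 u] fun _ => 0 := by
      filter_upwards [Iio_mem_nhds hu] with x hx
      simp [sqrtQuotient, not_lt.2 (le_of_lt (mem_Iio.1 hx))]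
    simpa [sqrtQuotient, hu.not_gt] using (hasDerivAt_const u (0 : ℝ)).congr_of_eventuallyEq h
  · rw [hasDerivAt_iff_isLittleO, isLittleO_iff]
    intro c hc
    have hs : Tendsto Real.sqrt (𝓝 0) (𝓝 0) := by
      simpa using Real.continuous_sqrt.tendsto 0
    filter_upwards [hs.eventually (isLittleO_iff.1 (hf.isLittleO_pow (m + 2)) hc)] with x hx
    by_cases h : 0 < x
    · have hp : 0 < √x := Real.sqrt_pos.2 h
      have hx2 : √x ^ 2 = x := Real.sq_sqrt h.le
      simp only [sqrtQuotient, h, if_true, lt_irrefl, if_false, sub_zero, mul_zero, smul_zero,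
        norm_div, norm_pow, Real.norm_eq_abs, abs_of_pos hp, abs_of_pos h] at hx ⊢
      rw [div_le_iff₀ (by positivity)]
      calc |f √x| ≤ c * √x ^ (m + 2) := hx
        _ = c * √x ^ 2 * √x ^ m := by ring
        _ = c * x * √x ^ m := by rw [hx2]
    · simp only [sqrtQuotient, h, if_false, lt_irrefl, sub_zero, mul_zero, smul_zero, norm_zero]
      positivity
  · have hp : 0 < √u := Real.sqrt_pos.2 hu
    have h : sqrtQuotient f m =ᶠ[𝓝 u] fun x => f √x / √x ^ m := by
      filter_upwards [Ioi_mem_nhds hu] with x hx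
      simp [sqrtQuotient, mem_Ioi.1 hx]
    have hs := Real.hasDerivAt_sqrt hu.ne'
    have hd : HasDerivAt f (deriv f √u) √u :=
      (hf.1.differentiable (by simp) _).hasDerivAt
    have := ((hd.comp u hs).div (hs.pow m) (pow_pos hp m).ne').congr_of_eventuallyEq h
    refine this.congr_deriv ?_
    symm
    simp only [sqrtQuotient, hu, if_true, Function.comp_apply, Pi.pow_apply]
    rcases m with _ | m
    · field_simp
      simp
      ring
    · push_cast
      field_simp
      ring

theorem IsFlatAtZero.contDiff_sqrtQuotient {f : ℝ → ℝ} (hf : IsFlatAtZero f) (m : ℕ) :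
    ContDiff ℝ (⊤ : ℕ∞) (sqrtQuotient f m) := by
  rw [contDiff_infty]
  intro N
  induction N generalizing f m with
  | zero =>
    exact contDiff_zero.2 (continuous_iff_continuousAt.2 fun u =>
      (hasDerivAt_sqrtQuotient hf m u).continuousAt)
  | succ N ih =>
    have hd : deriv (sqrtQuotient f m) = fun u =>
        1 / 2 * sqrtQuotient (deriv f) (m + 1) u - m / 2 * sqrtQuotient f (m + 2) u :=
      funext fun u => (hasDerivAt_sqrtQuotient hf m u).deriv
    push_cast
    rw [contDiff_succ_iff_deriv, hd]
    refine ⟨fun u => (hasDerivAt_sqrtQuotient hf m u).differentiableAt, by simp, ?_⟩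
    exact (contDiff_const.mul (ih (isFlatAtZero_deriv hf) _)).sub (contDiff_const.mul (ih hf _))

/-- **Borel's lemma**: every real sequence is the sequence of derivatives at the origin of a
smooth function. -/
theorem exists_contDiff_iteratedDeriv_zero_eq (a : ℕ → ℝ) :
    ∃ h : ℝ → ℝ, ContDiff ℝ (⊤ : ℕ∞) h ∧ ∀ k, iteratedDeriv k h 0 = a k := by
  let χ : ContDiffBump (0 : ℝ) := ⟨1, 2, one_pos, one_lt_two⟩
  let ψ : ℕ → ℝ → ℝ := fun n x => x ^ n * χ x
  have hψ : ∀ n, ContDiff ℝ (⊤ : ℕ∞) (ψ n) := fun n => (contDiff_id.pow n).mul χ.contDiff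
  have hψc : ∀ n, HasCompactSupport (ψ n) := fun n => χ.hasCompactSupport.mul_left
  have hψ0 : ∀ n k, iteratedDeriv k (ψ n) 0 = if k = n then (n ! : ℝ) else 0 := by
    intro n k
    have h : ψ n =ᶠ[𝓝 0] fun x => x ^ n := by
      filter_upwards [χ.eventuallyEq_one] with x hx
      simp [ψ, hx]
    rw [h.iteratedDeriv_eq, iteratedDeriv_fun_pow_zero]
    push_cast
    rfl
  have hB : ∀ n k, ∃ B : ℝ, 0 ≤ B ∧ ∀ x, ‖iteratedDeriv k (ψ n) x‖ ≤ B := by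
    intro n k
    have hc : Continuous (iteratedDeriv k (ψ n)) :=
      (hψ n).continuous_iteratedDeriv k (mod_cast le_top)
    have hs : HasCompactSupport (iteratedDeriv k (ψ n)) := by
      rw [iteratedDeriv_eq_iterate]
      induction k with
      | zero => exact hψc n
      | succ k ih =>
        rw [Function.iterate_succ_apply']
        exact (ih ((hψ n).continuous_iteratedDeriv k (mod_cast le_top))).deriv
    obtain ⟨B, hB⟩ := hc.bounded_above_of_compact_support hs
    exact ⟨B, (norm_nonneg _).trans (hB 0), hB⟩
  choose B hB0 hB using hB
  let b : ℕ → ℝ := fun n => a n / (n ! : ℝ)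
  let r : ℕ → ℝ := fun n => 1 + 2 ^ n * |b n| * ∑ k ∈ Finset.range n, B n k
  have hs0 : ∀ n, 0 ≤ ∑ k ∈ Finset.range n, B n k := fun n =>
    Finset.sum_nonneg fun k _ => hB0 n k
  have hr1 : ∀ n, 1 ≤ r n := fun n => le_add_of_nonneg_right (by have := hs0 n; positivity)
  have hr0 : ∀ n, 0 < r n := fun n => one_pos.trans_le (hr1 n)
  let θ : ℕ → ℝ → ℝ := fun n x => b n / r n ^ n * ψ n (r n * x)
  have hθ : ∀ n, ContDiff ℝ (⊤ : ℕ∞) (θ n) := fun n =>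
    contDiff_const.mul ((hψ n).comp (contDiff_const.mul contDiff_id))
  have hθd : ∀ n k x, iteratedDeriv k (θ n) x =
      b n / r n ^ n * (r n ^ k * iteratedDeriv k (ψ n) (r n * x)) := by
    intro n k x
    have h := congrFun (iteratedDeriv_comp_const_mul (n := k)
      ((hψ n).of_le (mod_cast le_top)) (r n)) x
    rw [← h]
    simp only [θ]
    rw [iteratedDeriv_const_mul_field]
  let v : ℕ → ℕ → ℝ := fun k n => |b n| / r n ^ n * (r n ^ k * B n k)
  have hv : ∀ k, Summable (v k) := by
    intro k
    refine Summable.of_norm_bounded_eventually_nat (g := fun n => (1 / 2 : ℝ) ^ n)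
      (summable_geometric_of_lt_one (by norm_num) (by norm_num)) ?_
    filter_upwards [eventually_gt_atTop k] with n hn
    have hrn := hr0 n
    have hBn := hB0 n k
    have hv0 : 0 ≤ v k n := by positivity
    have hle : B n k ≤ ∑ k ∈ Finset.range n, B n k :=
      Finset.single_le_sum (f := B n) (fun i _ => hB0 n i) (Finset.mem_range.2 hn)
    have hpow : r n ^ k * r n ≤ r n ^ n := by
      rw [← pow_succ]
      exact pow_le_pow_right₀ (hr1 n) hn
    have hrB : 2 ^ n * |b n| * B n k ≤ r n := by
      have : 2 ^ n * |b n| * B n k ≤ 2 ^ n * |b n| * ∑ k ∈ Finset.range n, B n k := by gcongr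
      simp only [r]
      linarith
    rw [Real.norm_of_nonneg hv0, one_div_pow, le_div_iff₀ (by positivity)]
    have : v k n * 2 ^ n = (2 ^ n * |b n| * B n k) * r n ^ k / r n ^ n := by
      simp only [v]; ring
    rw [this, div_le_one (by positivity)]
    calc (2 ^ n * |b n| * B n k) * r n ^ k ≤ r n * r n ^ k := by gcongr
      _ ≤ r n ^ n := by rw [mul_comm]; exact hpow
  have hbound : ∀ (k n : ℕ) (x : ℝ), (k : ℕ∞) ≤ ⊤ → ‖iteratedFDeriv ℝ k (θ n) x‖ ≤ v k n := by
    intro k n x _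
    have hrn := hr0 n
    rw [norm_iteratedFDeriv_eq_norm_iteratedDeriv, hθd, norm_mul, norm_mul, norm_div, norm_pow,
      norm_pow, Real.norm_of_nonneg hrn.le, Real.norm_eq_abs]
    simp only [v]
    gcongr
    exact hB _ _ _
  refine ⟨fun x => ∑' n, θ n x, contDiff_tsum hθ (fun k _ => hv k) hbound, fun k => ?_⟩
  have hsum : Summable fun n => iteratedFDeriv ℝ k (θ n) 0 :=
    .of_norm_bounded (hv k) fun n => hbound k n 0 le_top
  rw [iteratedDeriv_eq_iteratedFDeriv,
    iteratedFDeriv_tsum_apply hθ (fun k _ => hv k) hbound le_top,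
    ContinuousMultilinearMap.tsum_eval hsum]
  simp_rw [← iteratedDeriv_eq_iteratedFDeriv, hθd, mul_zero, hψ0]
  rw [tsum_eq_single k (fun n hn => by simp [hn.symm])]
  have := (hr0 k).ne'
  have := Nat.factorial_ne_zero k
  simp [b]
  field_simp

theorem iteratedDeriv_comp_sq_eq_zero {f : ℝ → ℝ} (hf : ContDiff ℝ (⊤ : ℕ∞) f) {n : ℕ}
    (h : ∀ k ≤ n, iteratedDeriv k f 0 = 0) : iteratedDeriv n (fun x => f (x ^ 2)) 0 = 0 := by
  have hsq : ContDiff ℝ (⊤ : ℕ∞) fun x : ℝ => x ^ 2 := contDiff_id.pow 2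
  let D : ℝ := 1 + ∑ i ∈ Finset.range (n + 1), ‖iteratedFDeriv ℝ i (fun x : ℝ => x ^ 2) 0‖
  have hD : 1 ≤ D := le_add_of_nonneg_right (Finset.sum_nonneg fun i _ => norm_nonneg _)
  have := norm_iteratedFDeriv_comp_le hf hsq (n := n) (mod_cast le_top) 0 (C := 0) (D := D)
    (fun i hi => by
      rw [norm_iteratedFDeriv_eq_norm_iteratedDeriv, zero_pow two_ne_zero, h i hi, norm_zero])
    (fun i hi1 hin => by
      have hi : ‖iteratedFDeriv ℝ i (fun x : ℝ => x ^ 2) 0‖ ≤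
          ∑ i ∈ Finset.range (n + 1), ‖iteratedFDeriv ℝ i (fun x : ℝ => x ^ 2) 0‖ :=
        Finset.single_le_sum (f := fun i => ‖iteratedFDeriv ℝ i (fun x : ℝ => x ^ 2) 0‖)
          (fun i _ => norm_nonneg _) (Finset.mem_range.2 (Nat.lt_succ_of_le hin))
      calc _ ≤ D := by simp only [D]; linarith
        _ ≤ D ^ i := le_self_pow₀ hD (by omega))
  rw [norm_iteratedFDeriv_eq_norm_iteratedDeriv, mul_zero, zero_mul] at this
  exact norm_le_zero_iff.1 this

theorem iteratedDeriv_comp_sq_zero {h : ℝ → ℝ} (hh : ContDiff ℝ (⊤ : ℕ∞) h) (n : ℕ) :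
    iteratedDeriv n (fun x => h (x ^ 2)) 0 =
      ∑ i ∈ Finset.range (n + 1),
        iteratedDeriv i h 0 / (i ! : ℝ) * (if n = 2 * i then (n ! : ℝ) else 0) := by
  let P : ℝ → ℝ := fun x => ∑ i ∈ Finset.range (n + 1), iteratedDeriv i h 0 / (i ! : ℝ) * x ^ i
  have hterm : ∀ i : ℕ, ContDiff ℝ (⊤ : ℕ∞) fun x : ℝ => iteratedDeriv i h 0 / (i ! : ℝ) * x ^ i :=
    fun i => contDiff_const.mul (contDiff_id.pow i)
  have hP : ContDiff ℝ (⊤ : ℕ∞) P := ContDiff.sum fun i _ => hterm i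
  have hPd : ∀ k ≤ n, iteratedDeriv k P 0 = iteratedDeriv k h 0 := by
    intro k hk
    rw [iteratedDeriv_fun_sum fun i _ => ((hterm i).of_le (mod_cast le_top)).contDiffAt]
    simp_rw [iteratedDeriv_const_mul_field, iteratedDeriv_fun_pow_zero]
    rw [Finset.sum_eq_single k (fun i _ hi => by simp [hi.symm])
      (fun hk' => absurd (Finset.mem_range.2 (Nat.lt_succ_of_le hk)) hk')]
    have := Nat.factorial_ne_zero k
    simp
    field_simp
  have hsq : ContDiff ℝ (⊤ : ℕ∞) fun x : ℝ => x ^ 2 := contDiff_id.pow 2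
  have hz := iteratedDeriv_comp_sq_eq_zero (hh.sub hP) (n := n) (fun k hk => by
    rw [iteratedDeriv_fun_sub (hh.of_le (mod_cast le_top)).contDiffAt
      (hP.of_le (mod_cast le_top)).contDiffAt, hPd k hk, sub_self])
  have hhsq : ContDiff ℝ (⊤ : ℕ∞) fun x => h (x ^ 2) := hh.comp hsq
  have hPsq : ContDiff ℝ (⊤ : ℕ∞) fun x => P (x ^ 2) := hP.comp hsq
  rw [iteratedDeriv_fun_sub (hhsq.of_le (mod_cast le_top)).contDiffAt
    (hPsq.of_le (mod_cast le_top)).contDiffAt, sub_eq_zero] at hz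
  rw [hz]
  simp only [P, ← pow_mul]
  rw [iteratedDeriv_fun_sum fun i _ =>
    (contDiff_const.mul (contDiff_id.pow (2 * i))).contDiffAt]
  refine Finset.sum_congr rfl fun i _ => ?_
  rw [iteratedDeriv_const_mul_field, iteratedDeriv_fun_pow_zero]
  by_cases hi : n = 2 * i <;> simp [hi]

/-- **Whitney's theorem**: a smooth even function is a smooth function of the square. -/
theorem exists_contDiff_comp_sq_eq {f : ℝ → ℝ} (hf : ContDiff ℝ (⊤ : ℕ∞) f)
    (heven : ∀ x, f (-x) = f x) :
    ∃ g : ℝ → ℝ, ContDiff ℝ (⊤ : ℕ∞) g ∧ ∀ x, f x = g (x ^ 2) := by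
  obtain ⟨h, hh, hhd⟩ := exists_contDiff_iteratedDeriv_zero_eq
    fun k => iteratedDeriv (2 * k) f 0 * (k ! : ℝ) / ((2 * k)! : ℝ)
  have hsq : ContDiff ℝ (⊤ : ℕ∞) fun x : ℝ => x ^ 2 := contDiff_id.pow 2
  have hhsq : ContDiff ℝ (⊤ : ℕ∞) fun x => h (x ^ 2) := hh.comp hsq
  have hodd : ∀ k, Odd k → iteratedDeriv k f 0 = 0 := by
    intro k hk
    have := iteratedDeriv_comp_neg k f 0
    simp only [heven, hk.neg_one_pow, neg_zero, neg_smul, one_smul] at this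
    linarith
  have hflat : IsFlatAtZero fun x => f x - h (x ^ 2) := by
    refine ⟨hf.sub hhsq, fun n => ?_⟩
    rw [iteratedDeriv_fun_sub (hf.of_le (mod_cast le_top)).contDiffAt
      (hhsq.of_le (mod_cast le_top)).contDiffAt, sub_eq_zero,
      iteratedDeriv_comp_sq_zero hh]
    rcases Nat.even_or_odd' n with ⟨k, rfl | rfl⟩
    · rw [Finset.sum_eq_single k (fun i _ hi => by rw [if_neg (by omega), mul_zero])
        (fun hk => absurd (Finset.mem_range.2 (by omega)) hk), if_pos rfl, hhd]
      have := Nat.factorial_ne_zero k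
      have := Nat.factorial_ne_zero (2 * k)
      field_simp
    · rw [hodd _ ⟨k, rfl⟩, Finset.sum_eq_zero fun i _ => by rw [if_neg (by omega), mul_zero]]
  refine ⟨fun u => h u + sqrtQuotient (fun x => f x - h (x ^ 2)) 0 u,
    hh.add (hflat.contDiff_sqrtQuotient 0), fun x => ?_⟩
  rcases eq_or_ne x 0 with rfl | hx
  · have := hflat.2 0
    simp only [iteratedDeriv_zero] at this
    simp only [sqrtQuotient, ne_eq, two_ne_zero, not_false_eq_true, zero_pow, lt_irrefl, if_false,
      add_zero] at this ⊢
    linarith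
  · have habs : f |x| = f x := by
      rcases abs_choice x with h | h <;> simp [h, heven]
    simp [sqrtQuotient, Real.sqrt_sq_eq_abs, habs, sq_pos_of_ne_zero hx]

/-- A smooth positive function on the line that is the identity on `[a, ∞)`. -/
theorem exists_contDiff_pos_eq_id {a : ℝ} (ha : 0 < a) :
    ∃ W : ℝ → ℝ, ContDiff ℝ (⊤ : ℕ∞) W ∧ (∀ v, 0 < W v) ∧ ∀ v, a ≤ v → W v = v := by
  let T : ℝ → ℝ := fun v => Real.smoothTransition ((2 * v - a) / a)
  refine ⟨fun v => T v * v + (1 - T v), ?_, fun v => ?_, fun v hv => ?_⟩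
  · have hT : ContDiff ℝ (⊤ : ℕ∞) T := Real.smoothTransition.contDiff.comp
      (((contDiff_const.mul contDiff_id).sub contDiff_const).div_const a)
    exact (hT.mul contDiff_id).add (contDiff_const.sub hT)
  · have h0 : 0 ≤ T v := Real.smoothTransition.nonneg _
    have h1 : T v ≤ 1 := Real.smoothTransition.le_one _
    rcases le_or_gt v 0 with hv | hv
    · have : T v = 0 := Real.smoothTransition.zero_of_nonpos
        (div_nonpos_of_nonpos_of_nonneg (by linarith) ha.le)
      simp [this]
    · rcases h0.eq_or_lt with h | h
      · simp [← h]
      · have := mul_pos h hv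
        simp only
        linarith
  · have : T v = 1 := Real.smoothTransition.one_of_one_le ((one_le_div ha).2 (by linarith))
    simp [this]

/-- A one-homogeneous function of `(u, v)` determined by a smooth even profile of `√(u / v)`
extends smoothly near every point with `v > 0`. -/
theorem exists_local_extension_of_homogeneous {L : ℝ × ℝ → ℝ} {f : ℝ → ℝ}
    (hf : ContDiff ℝ (⊤ : ℕ∞) f) (heven : ∀ x, f (-x) = f x)
    (hL : ∀ u v, 0 ≤ u → 0 < v → L (u, v) = v * f √(u / v)) {p : ℝ × ℝ} (hp : 0 < p.2) :
    ∃ U : Set (ℝ × ℝ), IsOpen U ∧ p ∈ U ∧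
      ∃ L' : ℝ × ℝ → ℝ, ContDiff ℝ (⊤ : ℕ∞) L' ∧ ∀ q ∈ U ∩ quadrantQ, L q = L' q := by
  obtain ⟨g, hg, hfg⟩ := exists_contDiff_comp_sq_eq hf heven
  obtain ⟨W, hW, hWpos, hWid⟩ := exists_contDiff_pos_eq_id (half_pos hp)
  refine ⟨{q | p.2 / 2 < q.2}, isOpen_lt continuous_const continuous_snd, half_lt_self hp,
    fun q => q.2 * g (q.1 / W q.2), ?_, ?_⟩
  · exact contDiff_snd.mul (hg.comp (contDiff_fst.div (hW.comp contDiff_snd)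
      fun q => (hWpos q.2).ne'))
  · rintro ⟨u, v⟩ ⟨hq, ⟨hu, -⟩, -⟩
    have hq : p.2 / 2 < v := hq
    have hv : 0 < v := (half_pos hp).trans hq
    simp only at hu ⊢
    rw [hL u v hu hv, hfg, Real.sq_sqrt (div_nonneg hu hv.le), hWid v hq.le]

/-- Strong convexity forces a Minkowski norm to be positive away from the origin. -/
theorem IsMinkowskiNorm.pos {E : Type*} [NormedAddCommGroup E] [NormedSpace ℝ E] {F : E → ℝ}
    (hF : IsMinkowskiNorm F) {y : E} (hy : y ≠ 0) : 0 < F y := by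
  obtain ⟨-, hnn, hsm, hhom, hconv⟩ := hF
  refine (hnn y).lt_of_ne' fun h0 => ?_
  have hG : ∀ t : ℝ, 0 < t → ContDiffAt ℝ (⊤ : ℕ∞) (fun w => F w ^ 2) (t • y) := fun t ht =>
    ((hsm.contDiffAt (isOpen_compl_singleton.mem_nhds (by simp [ht.ne', hy])))).pow 2
  have hline : ∀ t : ℝ, HasDerivAt (fun s : ℝ => s • y) y t := fun t => by
    simpa using (hasDerivAt_id t).smul_const y
  have hzero : ∀ t : ℝ, 0 < t → fderiv ℝ (fun w => F w ^ 2) (t • y) y = 0 := by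
    intro t ht
    have h1 := ((hG t ht).differentiableAt (by simp)).hasFDerivAt.comp_hasDerivAt t (hline t)
    refine h1.unique ((hasDerivAt_const t (0 : ℝ)).congr_of_eventuallyEq ?_)
    filter_upwards [Ioi_mem_nhds ht] with s hs
    simp [hhom s y hs, h0]
  have hd : DifferentiableAt ℝ (fun z => fderiv ℝ (fun w => F w ^ 2) z y) ((1 : ℝ) • y) :=
    ((((hG 1 one_pos).fderiv_right (m := 1) (by norm_cast)).clm_apply
      contDiffAt_const).differentiableAt (by simp))
  have h2 := hd.hasFDerivAt.comp_hasDerivAt 1 (hline 1)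
  have h3 := h2.unique ((hasDerivAt_const (1 : ℝ) (0 : ℝ)).congr_of_eventuallyEq (by
    filter_upwards [Ioi_mem_nhds one_pos] with s hs
    exact hzero s hs))
  rw [one_smul] at h3
  have := hconv y hy y hy
  rw [h3, mul_zero] at this
  exact this.false

/-- With `n₁ ≥ n₂ ≥ 2`, suppose `F(y) = √(L(α₁(y)², α₂(y)²))` (for
`y ≠ 0`, with `F(0) = 0`) is a Minkowski norm on `ℝⁿ = ℝ^{n₁} × ℝ^{n₂}`. Then `L` is
smooth on `Q = {(u,v) : u ≥ 0, v ≥ 0} ∖ {0}`, in the sense that around every point of `Q`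
it extends to a `C^∞` function on an open neighborhood in `ℝ²`. -/
theorem statement18 (n₁ n₂ : ℕ) (h21 : n₂ ≤ n₁) (h2 : 2 ≤ n₂)
    (L : ℝ × ℝ → ℝ) (F : (Fin n₁ → ℝ) × (Fin n₂ → ℝ) → ℝ)
    (hF0 : F 0 = 0)
    (hFy : ∀ y : (Fin n₁ → ℝ) × (Fin n₂ → ℝ), y ≠ 0 →
      F y = Real.sqrt (L (∑ i, y.1 i ^ 2, ∑ i, y.2 i ^ 2)))
    (hMink : IsMinkowskiNorm F) :
    ∀ p ∈ quadrantQ, ∃ U : Set (ℝ × ℝ), IsOpen U ∧ p ∈ U ∧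
      ∃ L' : ℝ × ℝ → ℝ, ContDiff ℝ (⊤ : ℕ∞) L' ∧ ∀ q ∈ U ∩ quadrantQ, L q = L' q := by
  let i : Fin n₁ := ⟨0, by omega⟩
  let j : Fin n₂ := ⟨0, by omega⟩
  let e : ℝ × ℝ → (Fin n₁ → ℝ) × (Fin n₂ → ℝ) := fun a => (Pi.single i a.1, Pi.single j a.2)
  have he0 : ∀ a, a ≠ 0 → e a ≠ 0 := by
    intro a ha h
    simp only [e, Prod.mk_eq_zero, Pi.single_eq_zero_iff] at h
    exact ha (Prod.ext h.1 h.2)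
  have hsum : ∀ (n : ℕ) (k : Fin n) (a : ℝ), ∑ l, (Pi.single k a : Fin n → ℝ) l ^ 2 = a ^ 2 := by
    intro n k a
    rw [Finset.sum_eq_single k (fun l _ hl => by simp [hl]) (by simp), Pi.single_eq_same]
  have hFe : ∀ a, a ≠ 0 → F (e a) = √(L (a.1 ^ 2, a.2 ^ 2)) := by
    intro a ha
    rw [hFy _ (he0 a ha), hsum, hsum]
  have hFe2 : ∀ a, a ≠ 0 → F (e a) ^ 2 = L (a.1 ^ 2, a.2 ^ 2) := by
    intro a ha
    have hpos := hMink.pos (he0 a ha)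
    rw [hFe a ha] at hpos ⊢
    exact Real.sq_sqrt (Real.sqrt_pos.1 hpos).le
  have hLe : ∀ u v, 0 ≤ u → 0 ≤ v → (√u, √v) ≠ 0 → L (u, v) = F (e (√u, √v)) ^ 2 := by
    intro u v hu hv huv
    rw [hFe2 _ huv, Real.sq_sqrt hu, Real.sq_sqrt hv]
  have hhom : ∀ c a, 0 < c → F (e (c • a)) ^ 2 = c ^ 2 * F (e a) ^ 2 := by
    intro c a hc
    have : e (c • a) = c • e a :=
      Prod.ext (Pi.single_smul (f := fun _ : Fin n₁ => ℝ) i c a.1)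
        (Pi.single_smul (f := fun _ : Fin n₂ => ℝ) j c a.2)
    rw [this, hMink.2.2.2.1 c _ hc, mul_pow]
  have hes : ContDiff ℝ (⊤ : ℕ∞) e :=
    ((ContinuousLinearMap.single ℝ (fun _ : Fin n₁ => ℝ) i).contDiff.comp contDiff_fst).prodMk
      ((ContinuousLinearMap.single ℝ (fun _ : Fin n₂ => ℝ) j).contDiff.comp contDiff_snd)
  have hsmooth : ∀ γ : ℝ → ℝ × ℝ, ContDiff ℝ (⊤ : ℕ∞) γ → (∀ t, γ t ≠ 0) →
      ContDiff ℝ (⊤ : ℕ∞) fun t => F (e (γ t)) ^ 2 := fun γ hγ h0 =>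
    (hMink.2.2.1.comp_contDiff (hes.comp hγ) fun t => he0 _ (h0 t)).pow 2
  rintro p ⟨⟨hp1, hp2⟩, hp0⟩
  rcases hp2.eq_or_lt with h | h
  · have hp : 0 < p.1 := hp1.lt_of_ne' fun h1 => hp0 (Prod.ext h1 h.symm)
    obtain ⟨U, hU, hpU, L', hL', hLL'⟩ := exists_local_extension_of_homogeneous
      (L := L ∘ Prod.swap) (f := fun t => F (e (1, t)) ^ 2) (p := p.swap)
      (hsmooth _ (contDiff_const.prodMk contDiff_id) (by simp))
      (fun x => by rw [hFe2 _ (by simp), hFe2 _ (by simp)]; simp)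
      (fun u v hu hv => by
        have hv' : √v ≠ 0 := (Real.sqrt_pos.2 hv).ne'
        have := hhom √v (1, √(u / v)) (Real.sqrt_pos.2 hv)
        rw [Real.sq_sqrt hv.le] at this
        simp only [Function.comp_apply, Prod.swap_prod_mk]
        rw [← this, hLe v u hv.le hu (by simp [hv'])]
        simp [Real.sqrt_div hu, mul_div_cancel₀ _ hv'])
      hp
    refine ⟨Prod.swap ⁻¹' U, hU.preimage continuous_swap, hpU, L' ∘ Prod.swap,
      hL'.comp (contDiff_snd.prodMk contDiff_fst), fun q hq => ?_⟩
    refine hLL' q.swap ⟨hq.1, ⟨hq.2.1.2, hq.2.1.1⟩, fun h => hq.2.2 ?_⟩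
    exact Prod.swap_injective h
  · exact exists_local_extension_of_homogeneous (f := fun t => F (e (t, 1)) ^ 2)
      (hsmooth _ (contDiff_id.prodMk contDiff_const) (by simp))
      (fun x => by rw [hFe2 _ (by simp), hFe2 _ (by simp)]; simp)
      (fun u v hu hv => by
        have hv' : √v ≠ 0 := (Real.sqrt_pos.2 hv).ne'
        have := hhom √v (√(u / v), 1) (Real.sqrt_pos.2 hv)
        rw [Real.sq_sqrt hv.le] at this
        rw [← this, hLe u v hu hv.le (by simp [hv'])]
        simp [Real.sqrt_div hu, mul_div_cancel₀ _ hv'])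
      h
end
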